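/- In the zero-noise (deterministic) system obtained by setting B_t ≡ 0, for every choice of initial conditions S_0 ≥ X_0 and V_0 ∈ ℝ one has lim_{t→∞} X_t/t = lim_{t→∞} S_t/t = −g. Moreover, if S_0 = X_0 and V_0 < 0, then for all t ≥ 0 the particles stay together and S_t = X_t, V_t = −g + (V_0 + g) e^{−t}; in particular V_t → −g as t → ∞. -/

import Mathlib

open MeasureTheory Filter Set

noncomputable section

/-- The zero-noise (deterministic) two-particle system: `dX = -dL`, `dV = dL - g dt`,
`dS = V dt`, with `S ≥ X`, where the collision local time `L` is continuous,
nondecreasing, and increases only when `S = X`. -/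
structure ZeroNoiseSystem (g : ℝ) where
  X : ℝ → ℝ
  S : ℝ → ℝ
  V : ℝ → ℝ
  L : ℝ → ℝ
  contX : Continuous X
  contS : Continuous S
  contV : Continuous V
  contL : Continuous L
  L_init : L 0 = 0
  monoL : MonotoneOn L (Ici 0)
  eqX : ∀ t : ℝ, 0 ≤ t → X t = X 0 - L t
  eqV : ∀ t : ℝ, 0 ≤ t → V t = V 0 + L t - g * t
  eqS : ∀ t : ℝ, 0 ≤ t → S t = S 0 + ∫ u in (0:ℝ)..t, V u
  X_le_S : ∀ t : ℝ, 0 ≤ t → X t ≤ S t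
  L_flat : ∀ s t : ℝ, 0 ≤ s → s ≤ t → (∀ u ∈ Icc s t, S u ≠ X u) → L t = L s

namespace ZeroNoiseSystem

variable {g : ℝ} (sys : ZeroNoiseSystem g)

/-- The position of the inert particle is differentiable with derivative `V`, up to extending it
by the integral formula to negative times. -/
lemma hasDerivAt_integral (t : ℝ) :
    HasDerivAt (fun t : ℝ => sys.S 0 + ∫ u in (0 : ℝ)..t, sys.V u) (sys.V t) t :=
  (intervalIntegral.integral_hasDerivAt_right (sys.contV.intervalIntegrable _ _)
    sys.contV.stronglyMeasurable.stronglyMeasurableAtFilter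
    sys.contV.continuousAt).const_add _

/-- The local time is constant across a time interval in whose interior the particles are apart. -/
lemma L_eq_of_ne {s t : ℝ} (hs : 0 ≤ s) (hst : s ≤ t)
    (h : ∀ u ∈ Ioo s t, sys.S u ≠ sys.X u) : sys.L t = sys.L s := by
  rcases hst.eq_or_lt with rfl | hlt
  · rfl
  have hflat : ∀ u ∈ Ioo s t, ∀ v ∈ Ioo s t, u ≤ v → sys.L v = sys.L u := fun u hu v hv huv =>
    sys.L_flat u v (hs.trans hu.1.le) huv fun w hw =>
      h w ⟨hu.1.trans_le hw.1, hw.2.trans_lt hv.2⟩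
  obtain ⟨p, hp⟩ := nonempty_Ioo.2 hlt
  have hconst : EqOn sys.L (fun _ => sys.L p) (Ioo s t) := fun u hu => by
    rcases le_total u p with hup | hup
    · exact (hflat u hu p hp hup).symm
    · exact hflat p hp u hu hup
  have hcl := hconst.closure sys.contL continuous_const
  rw [closure_Ioo hlt.ne] at hcl
  exact (hcl (right_mem_Icc.2 hst)).trans (hcl (left_mem_Icc.2 hst)).symm

lemma V_add_X {t : ℝ} (ht : 0 ≤ t) : sys.V t + sys.X t = sys.V 0 + sys.X 0 - g * t := by
  rw [sys.eqV t ht, sys.eqX t ht]; ring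

/-- As long as the velocity is nonpositive, particles that touch stay together. -/
lemma S_eq_X_of_V_nonpos {a b : ℝ} (ha : 0 ≤ a) (h0 : sys.S a = sys.X a)
    (hV : ∀ u ∈ Ioo a b, sys.V u ≤ 0) : ∀ t ∈ Icc a b, sys.S t = sys.X t := by
  intro t ht
  by_contra hne
  obtain ⟨s, ⟨hs, hsX⟩, hmax⟩ :=
    (isCompact_Icc.inter_right (isClosed_eq sys.contS sys.contX)).exists_isGreatest
      (s := Icc a t ∩ {u | sys.S u = sys.X u}) ⟨a, left_mem_Icc.2 ht.1, h0⟩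
  have hs0 : 0 ≤ s := ha.trans hs.1
  have hL : sys.L t = sys.L s := sys.L_eq_of_ne hs0 hs.2 fun u hu heq =>
    hu.1.not_ge (hmax ⟨⟨hs.1.trans hu.1.le, hu.2.le⟩, heq⟩)
  have hanti : AntitoneOn (fun t : ℝ => sys.S 0 + ∫ u in (0 : ℝ)..t, sys.V u) (Icc s t) := by
    refine antitoneOn_of_deriv_nonpos (convex_Icc s t)
      (fun u _ => (sys.hasDerivAt_integral u).continuousAt.continuousWithinAt)
      (fun u _ => (sys.hasDerivAt_integral u).differentiableAt.differentiableWithinAt) ?_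
    intro u hu
    rw [interior_Icc] at hu
    rw [(sys.hasDerivAt_integral u).deriv]
    exact hV u ⟨hs.1.trans_lt hu.1, hu.2.trans_le ht.2⟩
  have hS : sys.S t ≤ sys.S s := by
    have := hanti (left_mem_Icc.2 hs.2) (right_mem_Icc.2 hs.2) hs.2
    rwa [sys.eqS t (ha.trans ht.1), sys.eqS s hs0]
  have hX : sys.X t = sys.X s := by
    rw [sys.eqX t (ha.trans ht.1), sys.eqX s hs0, hL]
  have hsX : sys.S s = sys.X s := hsX
  exact hne (le_antisymm (by linarith) (sys.X_le_S t (ha.trans ht.1)))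

/-- While the particles stay together, the velocity relaxes exponentially to `-g`. -/
lemma V_eq_of_S_eq_X {a b : ℝ} (ha : 0 ≤ a) (hab : a ≤ b)
    (h : ∀ t ∈ Icc a b, sys.S t = sys.X t) :
    sys.V b = -g + (sys.V a + g) * Real.exp (-(b - a)) := by
  set W : ℝ → ℝ := fun t =>
    sys.V 0 + sys.X 0 - g * t - (sys.S 0 + ∫ u in (0 : ℝ)..t, sys.V u) with hW
  have hWV : ∀ t ∈ Icc a b, W t = sys.V t := fun t ht => by
    have ht0 := ha.trans ht.1
    have h1 := sys.V_add_X ht0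
    have h2 := h t ht
    have h3 := sys.eqS t ht0
    simp only [hW]
    linarith
  have hderiv : ∀ t, HasDerivAt (fun t => (W t + g) * Real.exp t)
      ((-g - sys.V t) * Real.exp t + (W t + g) * Real.exp t) t := fun t => by
    have h1 : HasDerivAt W (-g - sys.V t) t := by
      have h2 := (((hasDerivAt_id t).const_mul g).const_sub (sys.V 0 + sys.X 0)).sub
        (sys.hasDerivAt_integral t)
      simpa [hW, Pi.sub_def] using h2
    exact (h1.add_const g).mul (Real.hasDerivAt_exp t)
  have hconst := constant_of_has_deriv_right_zero (f := fun t => (W t + g) * Real.exp t)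
    (fun t _ => (hderiv t).continuousAt.continuousWithinAt)
    (fun t ht => by
      have h1 := hderiv t
      rw [hWV t (Ico_subset_Icc_self ht)] at h1
      convert h1.hasDerivWithinAt using 1
      ring) b (right_mem_Icc.2 hab)
  simp only [hWV b (right_mem_Icc.2 hab), hWV a (left_mem_Icc.2 hab)] at hconst
  have hexp : Real.exp (-(b - a)) * Real.exp b = Real.exp a := by
    rw [← Real.exp_add]; congr 1; ring
  have hb := Real.exp_pos b
  apply mul_right_cancel₀ hb.ne'
  linear_combination hconst - (sys.V a + g) * hexp

/-- Particles that touch while the velocity is negative stay together forever. -/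
lemma stick (hg : 0 < g) {a : ℝ} (ha : 0 ≤ a) (h0 : sys.S a = sys.X a) (hV : sys.V a < 0) :
    ∀ t, a ≤ t → sys.S t = sys.X t ∧
      sys.V t = -g + (sys.V a + g) * Real.exp (-(t - a)) := by
  have hneg : ∀ t, a ≤ t → sys.V t < 0 := by
    by_contra! hex
    obtain ⟨b, hab, hb⟩ := hex
    obtain ⟨τ, ⟨hτ, hτV⟩, hmin⟩ :=
      (isCompact_Icc.inter_right (isClosed_le continuous_const sys.contV)).exists_isLeast
        (s := Icc a b ∩ {u | 0 ≤ sys.V u}) ⟨b, right_mem_Icc.2 hab, hb⟩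
    have hstick := sys.S_eq_X_of_V_nonpos (b := τ) ha h0 fun u hu => by
      by_contra! hu0
      exact hu.2.not_ge (hmin ⟨⟨hu.1.le, hu.2.le.trans hτ.2⟩, hu0.le⟩)
    have hform := sys.V_eq_of_S_eq_X ha hτ.1 hstick
    have hle : Real.exp (-(τ - a)) ≤ 1 := Real.exp_le_one_iff.2 (by linarith [hτ.1])
    have hpos := Real.exp_pos (-(τ - a))
    have hτV : 0 ≤ sys.V τ := hτV
    rcases le_total (sys.V a + g) 0 with hc | hc <;> nlinarith
  intro t hat
  have hstick := sys.S_eq_X_of_V_nonpos (b := t) ha h0 fun u hu => (hneg u hu.1.le).le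
  exact ⟨hstick t (right_mem_Icc.2 hat), sys.V_eq_of_S_eq_X ha hat hstick⟩

/-- The particles collide after any given time. -/
lemma exists_S_eq_X (hg : 0 < g) {t : ℝ} (ht : 0 ≤ t) : ∃ u, t ≤ u ∧ sys.S u = sys.X u := by
  by_contra! hne
  have hL : ∀ u, t ≤ u → sys.L u = sys.L t := fun u hu =>
    sys.L_flat t u ht hu fun w hw => hne w hw.1
  have hVlin : ∀ u, t ≤ u → sys.V u = sys.V t - g * (u - t) := fun u hu => by
    rw [sys.eqV u (ht.trans hu), sys.eqV t ht, hL u hu]; ring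
  have hX : ∀ u, t ≤ u → sys.X u = sys.X t := fun u hu => by
    rw [sys.eqX u (ht.trans hu), sys.eqX t ht, hL u hu]
  have hS : ∀ u, t ≤ u →
      sys.S u = sys.S t + sys.V t * (u - t) - g * (u - t) ^ 2 / 2 := fun u hu => by
    have hint : ∫ w in t..u, sys.V w = sys.V t * (u - t) - g * (u - t) ^ 2 / 2 := by
      have hd : ∀ w ∈ uIcc t u,
          HasDerivAt (fun w => sys.V t * (w - t) - g * (w - t) ^ 2 / 2) (sys.V w) w := by
        intro w hw
        rw [uIcc_of_le hu] at hw
        have h1 := (hasDerivAt_id w).sub_const t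
        have h2 := (h1.const_mul (sys.V t)).sub (((h1.pow 2).const_mul g).div_const 2)
        refine HasDerivAt.congr_deriv h2 ?_
        rw [hVlin w hw.1]
        simp only [id_eq, Nat.cast_ofNat]
        ring
      rw [intervalIntegral.integral_eq_sub_of_hasDerivAt hd (sys.contV.intervalIntegrable _ _)]
      ring
    have hadd := intervalIntegral.integral_add_adjacent_intervals
      (sys.contV.intervalIntegrable (μ := volume) 0 t) (sys.contV.intervalIntegrable t u)
    rw [sys.eqS u (ht.trans hu), sys.eqS t ht, ← hadd, hint]
    ring
  set d := sys.S t - sys.X t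
  have hd0 : 0 ≤ d := sub_nonneg.2 (sys.X_le_S t ht)
  set r := 2 * (|sys.V t| + d + 1) / g + 1 with hr
  have hr1 : 1 ≤ r := le_add_of_nonneg_left (by positivity)
  have hgr : g * r = 2 * (|sys.V t| + d + 1) + g := by rw [hr]; field_simp
  have hu : t ≤ t + r := by linarith
  have hle := sys.X_le_S (t + r) (ht.trans hu)
  rw [hX _ hu, hS _ hu, add_sub_cancel_left] at hle
  have habs := le_abs_self (sys.V t)
  have hsq : g * r ^ 2 = (2 * (|sys.V t| + d + 1) + g) * r := by rw [← hgr]; ring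
  nlinarith [mul_le_mul_of_nonneg_right habs (zero_le_one.trans hr1),
    mul_nonneg hd0 (sub_nonneg.2 hr1), mul_pos hg (zero_lt_one.trans_le hr1)]

lemma exists_V_neg (hg : 0 < g) : ∃ t, 0 ≤ t ∧ sys.V t < 0 := by
  by_contra! hV
  have hmono : ∀ t, 0 ≤ t → sys.S 0 ≤ sys.S t := fun t ht => by
    rw [sys.eqS t ht]
    exact le_add_of_nonneg_right
      (intervalIntegral.integral_nonneg ht fun u hu => hV u hu.1)
  set T := (|sys.V 0 + sys.X 0 - sys.S 0| + 1) / g with hT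
  have hT0 : 0 ≤ T := by positivity
  have hgT : g * T = |sys.V 0 + sys.X 0 - sys.S 0| + 1 := by rw [hT]; field_simp
  obtain ⟨u, hu, heq⟩ := sys.exists_S_eq_X hg hT0
  have hu0 := hT0.trans hu
  have h1 := sys.V_add_X hu0
  have h2 := le_abs_self (sys.V 0 + sys.X 0 - sys.S 0)
  have h3 := mul_le_mul_of_nonneg_left hu hg.le
  linarith [hmono u hu0, hV u hu0]

lemma exists_S_eq_X_and_V_neg (hg : 0 < g) :
    ∃ a, 0 ≤ a ∧ sys.S a = sys.X a ∧ sys.V a < 0 := by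
  obtain ⟨t, ht, hVt⟩ := sys.exists_V_neg hg
  obtain ⟨b, htb, hb⟩ := sys.exists_S_eq_X hg ht
  obtain ⟨a, ⟨hta, haX⟩, hmin⟩ :=
    (isCompact_Icc.inter_right (isClosed_eq sys.contS sys.contX)).exists_isLeast
      (s := Icc t b ∩ {u | sys.S u = sys.X u}) ⟨b, right_mem_Icc.2 htb, hb⟩
  have hL := sys.L_eq_of_ne ht hta.1 fun u hu heq =>
    hu.2.not_ge (hmin ⟨⟨hu.1.le, hu.2.le.trans hta.2⟩, heq⟩)
  refine ⟨a, ht.trans hta.1, haX, ?_⟩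
  have h1 := sys.eqV a (ht.trans hta.1)
  have h2 := sys.eqV t ht
  have h3 := mul_le_mul_of_nonneg_left hta.1 hg.le
  linarith

/-- Particles that touch while the velocity is negative have limiting velocity `-g`. -/
lemma tendsto_V (hg : 0 < g) {a : ℝ} (ha : 0 ≤ a) (h0 : sys.S a = sys.X a) (hV : sys.V a < 0) :
    Tendsto sys.V atTop (nhds (-g)) := by
  have hexp : Tendsto (fun t : ℝ => Real.exp (-(t - a))) atTop (nhds 0) :=
    Real.tendsto_exp_neg_atTop_nhds_zero.comp (tendsto_atTop_add_const_right _ (-a) tendsto_id)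
  have hlim := (hexp.const_mul (sys.V a + g)).const_add (-g)
  rw [mul_zero, add_zero] at hlim
  refine hlim.congr' ?_
  filter_upwards [eventually_ge_atTop a] with t hat
  exact (sys.stick hg ha h0 hV t hat).2.symm

end ZeroNoiseSystem

/-- Remark 2.4: in the zero-noise case, for every initial condition `S₀ ≥ X₀`,
`V₀ ∈ ℝ`, one has `X_t/t → -g` and `S_t/t → -g`; moreover if `S₀ = X₀` and `V₀ < 0`
then the particles stay together with `S_t = X_t` and
`V_t = -g + (V₀ + g) e^{-t}` for all `t ≥ 0`, so in particular `V_t → -g`. -/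
theorem zero_noise_strong_law (g : ℝ) (hg : 0 < g) (sys : ZeroNoiseSystem g) :
    (Tendsto (fun t : ℝ => sys.X t / t) atTop (nhds (-g)) ∧
      Tendsto (fun t : ℝ => sys.S t / t) atTop (nhds (-g))) ∧
    (sys.S 0 = sys.X 0 → sys.V 0 < 0 →
      (∀ t : ℝ, 0 ≤ t →
        sys.S t = sys.X t ∧ sys.V t = -g + (sys.V 0 + g) * Real.exp (-t)) ∧
      Tendsto (fun t : ℝ => sys.V t) atTop (nhds (-g))) := by
  obtain ⟨a, ha, haX, haV⟩ := sys.exists_S_eq_X_and_V_neg hg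
  have hX : Tendsto (fun t : ℝ => sys.X t / t) atTop (nhds (-g)) := by
    have hlim : Tendsto (fun t : ℝ => (sys.V 0 + sys.X 0 - sys.V t) / t - g) atTop
        (nhds (0 - g)) :=
      (((sys.tendsto_V hg ha haX haV).const_sub _).div_atTop tendsto_id).sub_const g
    rw [zero_sub] at hlim
    refine hlim.congr' ?_
    filter_upwards [eventually_gt_atTop 0] with t ht
    have h := sys.V_add_X ht.le
    field_simp
    linarith
  refine ⟨⟨hX, hX.congr' ?_⟩, fun h0 hV => ⟨fun t ht => ?_, sys.tendsto_V hg le_rfl h0 hV⟩⟩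
  · filter_upwards [eventually_ge_atTop a] with t hat
    rw [(sys.stick hg ha haX haV t hat).1]
  · simpa using sys.stick hg le_rfl h0 hV t ht
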